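/- arXiv:2408.13867 — 8 statements merged into one kernel-verified Lean document; each statement's English description precedes it below -/
import Mathlib

section
/- For all integers q and s, the four triples (a₁,a₂,a₃) = ((s−1)t₁t₂t₃, sq(1−s)t₁t₅, (s²−q)t₁²t₄), (b₁,b₂,b₃) = ((s−1)q·t₁t₂t₃, −t₁²t₅, (s−1)s(s²−q)t₁t₄), (c₁,c₂,c₃) = ((1−s)t₁t₅, (s−1)q·t₁t₂t₄, s(s²−q)t₁²t₃), (d₁,d₂,d₃) = ((1−s)q·t₁t₅, (s−1)s·t₁t₂t₄, (s²−q)t₁²t₃) satisfy a₁+a₂+a₃ = b₁+b₂+b₃ = c₁+c₂+c₃ = d₁+d₂+d₃ and a₁a₂a₃ = b₁b₂b₃ = c₁c₂c₃ = d₁d₂d₃; that is, they form a two-parameter family of four triples of integers with equal sums and equal products. -/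
/-- For all integers `q` and `s`, with `t₁, t₂, t₃, t₄, t₅` the polynomials in `q, s`
from Proposition 1 of the paper, the four triples
`(a₁,a₂,a₃) = ((s−1)t₁t₂t₃, sq(1−s)t₁t₅, (s²−q)t₁²t₄)`,
`(b₁,b₂,b₃) = ((s−1)q·t₁t₂t₃, −t₁²t₅, (s−1)s(s²−q)t₁t₄)`,
`(c₁,c₂,c₃) = ((1−s)t₁t₅, (s−1)q·t₁t₂t₄, s(s²−q)t₁²t₃)`,
`(d₁,d₂,d₃) = ((1−s)q·t₁t₅, (s−1)s·t₁t₂t₄, (s²−q)t₁²t₃)`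
have equal sums and equal products. -/
theorem stmt_0 (q s t₁ t₂ t₃ t₄ t₅ a₁ a₂ a₃ b₁ b₂ b₃ c₁ c₂ c₃ d₁ d₂ d₃ : ℤ)
    (ht₁ : t₁ = q^2*s^2 - 2*q^2*s + q*s + q - 1)
    (ht₂ : t₂ = q^2*s^2 - 2*q^2*s + q*s^2 - q*s + s^2 + q - s)
    (ht₃ : t₃ = q^3*s^3 - q^2*s^4 - 4*q^3*s^2 + 5*q^2*s^3 - q*s^4 + 4*q^3*s - 6*q^2*s^2
      + 2*q*s^3 - s^4 + q^2*s + 2*s^3 - 2*q^2 + q*s - 2*s^2 + q)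
    (ht₄ : t₄ = -q^2*s^5 + q^3*s^3 + 4*q^2*s^4 - 4*q^3*s^2 - 4*q^2*s^3 - 2*q*s^4 + 4*q^3*s
      + q^2*s^2 + 4*q*s^3 - q^2*s - s^3 - 2*q^2 - q*s + s^2 + 2*q - s)
    (ht₅ : t₅ = q^2*s^7 + q^4*s^4 - 3*q^3*s^5 - 4*q^2*s^6 + q*s^7 - 4*q^4*s^3 + 15*q^3*s^4
      - q*s^6 + 4*q^4*s^2 - 22*q^3*s^3 + 12*q^2*s^4 - 5*q*s^5 + 2*s^6 + 10*q^3*s^2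
      - 12*q^2*s^3 + 7*q*s^4 - 4*s^5 - 4*q^3*s + 12*q^2*s^2 - 7*q*s^3 + 4*s^4
      - 4*q^2*s + q*s^2 - s^3 + q^2)
    (ha : a₁ = (s - 1)*t₁*t₂*t₃ ∧ a₂ = s*q*(1 - s)*t₁*t₅ ∧ a₃ = (s^2 - q)*t₁^2*t₄)
    (hb : b₁ = (s - 1)*q*t₁*t₂*t₃ ∧ b₂ = -t₁^2*t₅ ∧ b₃ = (s - 1)*s*(s^2 - q)*t₁*t₄)
    (hc : c₁ = (1 - s)*t₁*t₅ ∧ c₂ = (s - 1)*q*t₁*t₂*t₄ ∧ c₃ = s*(s^2 - q)*t₁^2*t₃)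
    (hd : d₁ = (1 - s)*q*t₁*t₅ ∧ d₂ = (s - 1)*s*t₁*t₂*t₄ ∧ d₃ = (s^2 - q)*t₁^2*t₃) :
    (a₁ + a₂ + a₃ = b₁ + b₂ + b₃ ∧ b₁ + b₂ + b₃ = c₁ + c₂ + c₃ ∧
      c₁ + c₂ + c₃ = d₁ + d₂ + d₃) ∧
    (a₁ * a₂ * a₃ = b₁ * b₂ * b₃ ∧ b₁ * b₂ * b₃ = c₁ * c₂ * c₃ ∧
      c₁ * c₂ * c₃ = d₁ * d₂ * d₃) := by
  obtain ⟨rfl, rfl, rfl⟩ := ha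
  obtain ⟨rfl, rfl, rfl⟩ := hb
  obtain ⟨rfl, rfl, rfl⟩ := hc
  obtain ⟨rfl, rfl, rfl⟩ := hd
  refine ⟨?_, by ring, by ring, by ring⟩
  -- Each sum is a multiple of `t₁`, so the equalities reduce to identities between the cofactors.
  have hab : (s - 1)*t₂*t₃ + s*q*(1 - s)*t₅ + (s^2 - q)*t₁*t₄
      = (s - 1)*q*t₂*t₃ - t₁*t₅ + (s - 1)*s*(s^2 - q)*t₄ := by
    subst ht₁ ht₂ ht₃ ht₄ ht₅
    ring
  have hbc : (s - 1)*q*t₂*t₃ - t₁*t₅ + (s - 1)*s*(s^2 - q)*t₄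
      = (1 - s)*t₅ + (s - 1)*q*t₂*t₄ + s*(s^2 - q)*t₁*t₃ := by
    subst ht₁ ht₂ ht₃ ht₄ ht₅
    ring
  have hcd : (1 - s)*t₅ + (s - 1)*q*t₂*t₄ + s*(s^2 - q)*t₁*t₃
      = (1 - s)*q*t₅ + (s - 1)*s*t₂*t₄ + (s^2 - q)*t₁*t₃ := by
    subst ht₁ ht₂ ht₃ ht₄ ht₅
    ring
  refine ⟨?_, ?_, ?_⟩
  · linear_combination t₁ * hab
  · linear_combination t₁ * hbc
  · linear_combination t₁ * hcd
end

section
/- Let a₁, a₂, a₃, b₁, b₂, b₃, e₁, e₂ be rational numbers such that a₁+a₂+a₃ = b₁+b₂+b₃ = M, a₁a₂a₃ = b₁b₂b₃ = N, and T₁ + e₁² = T₂ + e₂², where T₁ = a₁a₂+a₂a₃+a₁a₃ and T₂ = b₁b₂+b₂b₃+b₁b₃. Then each of the seven points P₁ = (0, N), P_{ij} = (−a_i a_j, a_i a_j e₁) for 1 ≤ i < j ≤ 3, and Q_{ij} = (−b_i b_j, b_i b_j e₂) for 1 ≤ i < j ≤ 3, satisfies the equation y² = x³ + (T₁+e₁²)x²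 + MNx + N². -/
/-- If `a, b, c` have sum `M` and product `N`, and `A = ab + bc + ac + e²`, then `(-ab, abe)`
lies on `y² = x³ + A x² + M N x + N²`. -/
theorem neg_mul_point_on_cubic {R : Type*} [CommRing R] {a b c e M N A : R}
    (hM : a + b + c = M) (hN : a * b * c = N) (hA : A = a * b + b * c + a * c + e ^ 2) :
    (a * b * e) ^ 2 = (-(a * b)) ^ 3 + A * (-(a * b)) ^ 2 + M * N * (-(a * b)) + N ^ 2 := by
  subst hM hN hA
  ring

/-- Given two triples of rationals with the same sum `M`, the same product `N`, and
rationals `e₁, e₂` with `T₁ + e₁² = T₂ + e₂²`, the seven points `P₁ = (0, N)`,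
`P_{ij} = (−a_i a_j, a_i a_j e₁)` and `Q_{ij} = (−b_i b_j, b_i b_j e₂)`, `1 ≤ i < j ≤ 3`,
all satisfy `y² = x³ + (T₁+e₁²)x² + MNx + N²`. -/
theorem stmt_9 (a₁ a₂ a₃ b₁ b₂ b₃ e₁ e₂ M N T₁ T₂ : ℚ)
    (hM₁ : a₁ + a₂ + a₃ = M) (hM₂ : b₁ + b₂ + b₃ = M)
    (hN₁ : a₁ * a₂ * a₃ = N) (hN₂ : b₁ * b₂ * b₃ = N)
    (hT₁ : T₁ = a₁ * a₂ + a₂ * a₃ + a₁ * a₃)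
    (hT₂ : T₂ = b₁ * b₂ + b₂ * b₃ + b₁ * b₃)
    (he : T₁ + e₁ ^ 2 = T₂ + e₂ ^ 2) :
    (N ^ 2 = 0 ^ 3 + (T₁ + e₁ ^ 2) * 0 ^ 2 + M * N * 0 + N ^ 2) ∧
    ((a₁ * a₂ * e₁) ^ 2 = (-(a₁ * a₂)) ^ 3 + (T₁ + e₁ ^ 2) * (-(a₁ * a₂)) ^ 2
      + M * N * (-(a₁ * a₂)) + N ^ 2) ∧
    ((a₂ * a₃ * e₁) ^ 2 = (-(a₂ * a₃)) ^ 3 + (T₁ + e₁ ^ 2) * (-(a₂ * a₃)) ^ 2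
      + M * N * (-(a₂ * a₃)) + N ^ 2) ∧
    ((a₁ * a₃ * e₁) ^ 2 = (-(a₁ * a₃)) ^ 3 + (T₁ + e₁ ^ 2) * (-(a₁ * a₃)) ^ 2
      + M * N * (-(a₁ * a₃)) + N ^ 2) ∧
    ((b₁ * b₂ * e₂) ^ 2 = (-(b₁ * b₂)) ^ 3 + (T₁ + e₁ ^ 2) * (-(b₁ * b₂)) ^ 2
      + M * N * (-(b₁ * b₂)) + N ^ 2) ∧
    ((b₂ * b₃ * e₂) ^ 2 = (-(b₂ * b₃)) ^ 3 + (T₁ + e₁ ^ 2) * (-(b₂ * b₃)) ^ 2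
      + M * N * (-(b₂ * b₃)) + N ^ 2) ∧
    ((b₁ * b₃ * e₂) ^ 2 = (-(b₁ * b₃)) ^ 3 + (T₁ + e₁ ^ 2) * (-(b₁ * b₃)) ^ 2
      + M * N * (-(b₁ * b₃)) + N ^ 2) := by
  refine ⟨by ring,
    neg_mul_point_on_cubic (c := a₃) ?_ ?_ ?_, neg_mul_point_on_cubic (c := a₁) ?_ ?_ ?_,
    neg_mul_point_on_cubic (c := a₂) ?_ ?_ ?_, neg_mul_point_on_cubic (c := b₃) ?_ ?_ ?_,
    neg_mul_point_on_cubic (c := b₁) ?_ ?_ ?_, neg_mul_point_on_cubic (c := b₂) ?_ ?_ ?_⟩ <;>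
  linarith
end

section
/- For all elements p, q, r of a commutative ring, setting s = pqr(r−p)+p²−p−r+1, w = q(r²−p−r+1)+p−r, z = pqr(qr−q−1)+p+q−1, the three triples (a₁,a₂,a₃) = (pqrw, s, z), (b₁,b₂,b₃) = (w, qrs, pz), (c₁,c₂,c₃) = (pw, qs, rz) satisfy a₁+a₂+a₃ = b₁+b₂+b₃ = c₁+c₂+c₃ and a₁a₂a₃ = b₁b₂b₃ = c₁c₂c₃. -/
/-- For all elements `p, q, r` of a commutative ring, with
`s = pqr(r−p)+p²−p−r+1`, `w = q(r²−p−r+1)+p−r`, `z = pqr(qr−q−1)+p+q−1`,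
the three triples `(pqrw, s, z)`, `(w, qrs, pz)`, `(pw, qs, rz)` have equal sums
and equal products. -/
theorem stmt_10 {R : Type*} [CommRing R] (p q r s w z : R)
    (hs : s = p * q * r * (r - p) + p ^ 2 - p - r + 1)
    (hw : w = q * (r ^ 2 - p - r + 1) + p - r)
    (hz : z = p * q * r * (q * r - q - 1) + p + q - 1) :
    (p * q * r * w + s + z = w + q * r * s + p * z ∧
      w + q * r * s + p * z = p * w + q * s + r * z) ∧
    (p * q * r * w * s * z = w * (q * r * s) * (p * z) ∧
      w * (q * r * s) * (p * z) = p * w * (q * s) * (r * z)) := by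
  refine ⟨⟨?_, ?_⟩, by ring, by ring⟩ <;> subst hs hw hz <;> ring
end

section
/- Let T₁, T₂, T₃, h, k be elements of a commutative ring, and set A = −4hk(h−k)((T₁−T₂)h−(T₁−T₃)k), B = (T₁−T₂)h²−(T₁−T₃)k², m₁ = (T₁−T₂)h²−2(T₁−T₂)hk+(T₁−T₃)k², m₂ = (T₁−T₂)h²−2(T₁−T₃)hk+(T₁−T₃)k². Then A(T₁−T₂) = m₁² − B² and A(T₁−T₃) = m₂² − B². -/
/-- For elements `T₁, T₂, T₃, h, k` of a commutative ring, with
`A = −4hk(h−k)((T₁−T₂)h−(T₁−T₃)k)`, `B = (T₁−T₂)h²−(T₁−T₃)k²`,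
`m₁ = (T₁−T₂)h²−2(T₁−T₂)hk+(T₁−T₃)k²`, `m₂ = (T₁−T₂)h²−2(T₁−T₃)hk+(T₁−T₃)k²`,
one has `A(T₁−T₂) = m₁² − B²` and `A(T₁−T₃) = m₂² − B²`. -/
theorem stmt_12 {R : Type*} [CommRing R] (T₁ T₂ T₃ h k A B m₁ m₂ : R)
    (hA : A = -4 * h * k * (h - k) * ((T₁ - T₂) * h - (T₁ - T₃) * k))
    (hB : B = (T₁ - T₂) * h ^ 2 - (T₁ - T₃) * k ^ 2)
    (hm₁ : m₁ = (T₁ - T₂) * h ^ 2 - 2 * (T₁ - T₂) * h * k + (T₁ - T₃) * k ^ 2)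
    (hm₂ : m₂ = (T₁ - T₂) * h ^ 2 - 2 * (T₁ - T₃) * h * k + (T₁ - T₃) * k ^ 2) :
    A * (T₁ - T₂) = m₁ ^ 2 - B ^ 2 ∧ A * (T₁ - T₃) = m₂ ^ 2 - B ^ 2 := by
  subst hA hB hm₁ hm₂
  constructor <;> ring
end

section
/- Let a₁, a₂, a₃, b₁, b₂, b₃, c₁, c₂, c₃ be rational numbers such that all three triples have the same sum M = a₁+a₂+a₃ and the same product N = a₁a₂a₃, and set T₁ = a₁a₂+a₂a₃+a₁a₃, T₂ = b₁b₂+b₂b₃+b₁b₃, T₃ = c₁c₂+c₂c₃+c₁c₃. Let A, B, m₁, m₂ be rational numbers with A(T₁−T₂) = m₁² − B² and A(T₁−T₃) = m₂² − B², and let f₁(x) = (x+a₁)(x+a₂)(x+a₃). Then each of the nine points (−a_i, a_iB), (−b_i, b_i m₁), (−c_i, c_i m₂), i = 1, 2, 3, satisfies the equation y² = Axf₁(x) + B²x². -/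
/-- If the triples `(a₁, a₂, a₃)` and `(b, p, q)` have the same sum and the same product, and the
difference of their pairwise-product sums times `A` is `m² − B²`, then the point `(−b, b m)` lies on
the curve `y² = A x (x + a₁) (x + a₂) (x + a₃) + B² x²`. -/
theorem point_on_curve_of_same_sum_prod {R : Type*} [CommRing R] {a₁ a₂ a₃ b p q A B m : R}
    (hsum : a₁ + a₂ + a₃ = b + p + q) (hprod : a₁ * a₂ * a₃ = b * p * q)
    (hm : A * (a₁ * a₂ + a₂ * a₃ + a₁ * a₃ - (b * p + p * q + b * q)) = m ^ 2 - B ^ 2) :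
    (b * m) ^ 2 = A * (-b) * ((-b + a₁) * (-b + a₂) * (-b + a₃)) + B ^ 2 * (-b) ^ 2 := by
  linear_combination A * b ^ 3 * hsum + A * b * hprod - b ^ 2 * hm

/-- Given three triples of rationals with the same sum `M` and the same product `N`,
pairwise-product sums `T₁, T₂, T₃`, and rationals `A, B, m₁, m₂` with
`A(T₁−T₂) = m₁² − B²` and `A(T₁−T₃) = m₂² − B²`, each of the nine points
`(−a_i, a_iB)`, `(−b_i, b_i m₁)`, `(−c_i, c_i m₂)`, `i = 1, 2, 3`, satisfies
`y² = Axf₁(x) + B²x²` where `f₁(x) = (x+a₁)(x+a₂)(x+a₃)`. -/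
theorem stmt_13 (a₁ a₂ a₃ b₁ b₂ b₃ c₁ c₂ c₃ M N T₁ T₂ T₃ A B m₁ m₂ : ℚ)
    (hMa : a₁ + a₂ + a₃ = M) (hMb : b₁ + b₂ + b₃ = M) (hMc : c₁ + c₂ + c₃ = M)
    (hNa : a₁ * a₂ * a₃ = N) (hNb : b₁ * b₂ * b₃ = N) (hNc : c₁ * c₂ * c₃ = N)
    (hT₁ : T₁ = a₁ * a₂ + a₂ * a₃ + a₁ * a₃)
    (hT₂ : T₂ = b₁ * b₂ + b₂ * b₃ + b₁ * b₃)
    (hT₃ : T₃ = c₁ * c₂ + c₂ * c₃ + c₁ * c₃)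
    (hm₁ : A * (T₁ - T₂) = m₁ ^ 2 - B ^ 2)
    (hm₂ : A * (T₁ - T₃) = m₂ ^ 2 - B ^ 2)
    (f₁ : ℚ → ℚ) (hf₁ : ∀ x, f₁ x = (x + a₁) * (x + a₂) * (x + a₃)) :
    ((a₁ * B) ^ 2 = A * (-a₁) * f₁ (-a₁) + B ^ 2 * (-a₁) ^ 2) ∧
    ((a₂ * B) ^ 2 = A * (-a₂) * f₁ (-a₂) + B ^ 2 * (-a₂) ^ 2) ∧
    ((a₃ * B) ^ 2 = A * (-a₃) * f₁ (-a₃) + B ^ 2 * (-a₃) ^ 2) ∧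
    ((b₁ * m₁) ^ 2 = A * (-b₁) * f₁ (-b₁) + B ^ 2 * (-b₁) ^ 2) ∧
    ((b₂ * m₁) ^ 2 = A * (-b₂) * f₁ (-b₂) + B ^ 2 * (-b₂) ^ 2) ∧
    ((b₃ * m₁) ^ 2 = A * (-b₃) * f₁ (-b₃) + B ^ 2 * (-b₃) ^ 2) ∧
    ((c₁ * m₂) ^ 2 = A * (-c₁) * f₁ (-c₁) + B ^ 2 * (-c₁) ^ 2) ∧
    ((c₂ * m₂) ^ 2 = A * (-c₂) * f₁ (-c₂) + B ^ 2 * (-c₂) ^ 2) ∧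
    ((c₃ * m₂) ^ 2 = A * (-c₃) * f₁ (-c₃) + B ^ 2 * (-c₃) ^ 2) := by
  subst hT₁ hT₂ hT₃
  simp only [hf₁]
  refine ⟨by ring, by ring, by ring, ?_, ?_, ?_, ?_, ?_, ?_⟩
  · exact point_on_curve_of_same_sum_prod (p := b₂) (q := b₃)
      (by linear_combination hMa - hMb) (by linear_combination hNa - hNb)
      (by linear_combination hm₁)
  · exact point_on_curve_of_same_sum_prod (p := b₃) (q := b₁)
      (by linear_combination hMa - hMb) (by linear_combination hNa - hNb)
      (by linear_combination hm₁)
  · exact point_on_curve_of_same_sum_prod (p := b₁) (q := b₂)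
      (by linear_combination hMa - hMb) (by linear_combination hNa - hNb)
      (by linear_combination hm₁)
  · exact point_on_curve_of_same_sum_prod (p := c₂) (q := c₃)
      (by linear_combination hMa - hMc) (by linear_combination hNa - hNc)
      (by linear_combination hm₂)
  · exact point_on_curve_of_same_sum_prod (p := c₃) (q := c₁)
      (by linear_combination hMa - hMc) (by linear_combination hNa - hNc)
      (by linear_combination hm₂)
  · exact point_on_curve_of_same_sum_prod (p := c₁) (q := c₂)
      (by linear_combination hMa - hMc) (by linear_combination hNa - hNc)
      (by linear_combination hm₂)
end

section
/- Let A, B, M, T₁, N be elements of a field and let (x, y) satisfy y² = Ax(x³ + Mx² + T₁x + N) + B²x² with x ≠ 0. Then X = AN/x and Y = ANy/x² satisfy Y² = X³ + (AT₁+B²)X² + A²MNX + A³N². -/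
/-- If `(x, y)` with `x ≠ 0` satisfies the quartic `y² = Ax(x³ + Mx² + T₁x + N) + B²x²`
over a field, then `X = AN/x`, `Y = ANy/x²` satisfy the cubic
`Y² = X³ + (AT₁+B²)X² + A²MNX + A³N²`. -/
theorem stmt_14 {F : Type*} [Field F] (A B M T₁ N x y : F) (hx : x ≠ 0)
    (h : y ^ 2 = A * x * (x ^ 3 + M * x ^ 2 + T₁ * x + N) + B ^ 2 * x ^ 2) :
    (A * N * y / x ^ 2) ^ 2 =
      (A * N / x) ^ 3 + (A * T₁ + B ^ 2) * (A * N / x) ^ 2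
        + A ^ 2 * M * N * (A * N / x) + A ^ 3 * N ^ 2 := by
  rw [div_pow, mul_pow, h]
  field_simp
  ring
end

section
/- Let (a₁,a₂,a₃), (b₁,b₂,b₃), (c₁,c₂,c₃), (d₁,d₂,d₃) be four triples of rational numbers, all with the same sum M and the same product N, let T₁, T₂, T₃, T₄ denote the sums of pairwise products of the four triples, and assume T = T₁+T₂−T₃−T₄ ≠ 0. Define f₁(x) = (x+a₁)(x+a₂)(x+a₃)(x+b₁)(x+b₂)(x+b₃), f₂(x) = (x+c₁)(x+c₂)(x+c₃)(x+d₁)(x+d₂)(x+d₃), φ₁(x) = x³ + Mx² + ((4(T₁T₂−T₃T₄)+T²)/(4T))x + N, φ₂(x) = x³ + Mx² + ((4(T₁T₂−T₃T₄)−T²)/(4T))x + N, K = −(T² + 2(T₃+T₄)T − 4(T₁T₂−T₃T₄))/(2T), and H = (T²+4(T₁T₂−T₃T₄))²/(16T²) − T₁T₂. Then for every rational x and for i = 1, 2, φ_i(x)² − f_i(x) = Kx⁴ + MKx³ + Hx² + NKx. -/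
/-- A monic cubic with roots `-u, -v, -w`, expanded in the elementary symmetric functions. -/
lemma cubic_eq_of_esymm {R : Type*} [CommRing R] {u v w M N T : R} (hM : u + v + w = M)
    (hN : u * v * w = N) (hT : T = u * v + v * w + u * w) (x : R) :
    (x + u) * (x + v) * (x + w) = x ^ 3 + M * x ^ 2 + T * x + N := by
  subst hM hN hT
  ring

/-- Let four triples of rationals have the same sum `M`, the same product `N`, and
pairwise-product sums `T₁, T₂, T₃, T₄` with `T = T₁+T₂−T₃−T₄ ≠ 0`. With
`f₁(x) = (x+a₁)(x+a₂)(x+a₃)(x+b₁)(x+b₂)(x+b₃)`,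
`f₂(x) = (x+c₁)(x+c₂)(x+c₃)(x+d₁)(x+d₂)(x+d₃)`,
`φ₁(x) = x³ + Mx² + ((4(T₁T₂−T₃T₄)+T²)/(4T))x + N`,
`φ₂(x) = x³ + Mx² + ((4(T₁T₂−T₃T₄)−T²)/(4T))x + N`,
`K = −(T² + 2(T₃+T₄)T − 4(T₁T₂−T₃T₄))/(2T)`,
`H = (T²+4(T₁T₂−T₃T₄))²/(16T²) − T₁T₂`,
one has `φᵢ(x)² − fᵢ(x) = Kx⁴ + MKx³ + Hx² + NKx` for `i = 1, 2` and all rational `x`. -/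
theorem stmt_17 (a₁ a₂ a₃ b₁ b₂ b₃ c₁ c₂ c₃ d₁ d₂ d₃ M N T₁ T₂ T₃ T₄ T K H : ℚ)
    (hMa : a₁ + a₂ + a₃ = M) (hMb : b₁ + b₂ + b₃ = M)
    (hMc : c₁ + c₂ + c₃ = M) (hMd : d₁ + d₂ + d₃ = M)
    (hNa : a₁ * a₂ * a₃ = N) (hNb : b₁ * b₂ * b₃ = N)
    (hNc : c₁ * c₂ * c₃ = N) (hNd : d₁ * d₂ * d₃ = N)
    (hT₁ : T₁ = a₁ * a₂ + a₂ * a₃ + a₁ * a₃)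
    (hT₂ : T₂ = b₁ * b₂ + b₂ * b₃ + b₁ * b₃)
    (hT₃ : T₃ = c₁ * c₂ + c₂ * c₃ + c₁ * c₃)
    (hT₄ : T₄ = d₁ * d₂ + d₂ * d₃ + d₁ * d₃)
    (hT : T = T₁ + T₂ - T₃ - T₄) (hT0 : T ≠ 0)
    (f₁ f₂ φ₁ φ₂ : ℚ → ℚ)
    (hf₁ : ∀ x, f₁ x = (x + a₁) * (x + a₂) * (x + a₃)
      * ((x + b₁) * (x + b₂) * (x + b₃)))
    (hf₂ : ∀ x, f₂ x = (x + c₁) * (x + c₂) * (x + c₃)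
      * ((x + d₁) * (x + d₂) * (x + d₃)))
    (hφ₁ : ∀ x, φ₁ x = x ^ 3 + M * x ^ 2
      + ((4 * (T₁ * T₂ - T₃ * T₄) + T ^ 2) / (4 * T)) * x + N)
    (hφ₂ : ∀ x, φ₂ x = x ^ 3 + M * x ^ 2
      + ((4 * (T₁ * T₂ - T₃ * T₄) - T ^ 2) / (4 * T)) * x + N)
    (hK : K = -(T ^ 2 + 2 * (T₃ + T₄) * T - 4 * (T₁ * T₂ - T₃ * T₄)) / (2 * T))
    (hH : H = (T ^ 2 + 4 * (T₁ * T₂ - T₃ * T₄)) ^ 2 / (16 * T ^ 2) - T₁ * T₂)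
    (x : ℚ) :
    φ₁ x ^ 2 - f₁ x = K * x ^ 4 + M * K * x ^ 3 + H * x ^ 2 + N * K * x ∧
    φ₂ x ^ 2 - f₂ x = K * x ^ 4 + M * K * x ^ 3 + H * x ^ 2 + N * K * x := by
  have hT₁' : T₁ = T + T₃ + T₄ - T₂ := by rw [hT]; ring
  rw [hφ₁, hφ₂, hf₁, hf₂, cubic_eq_of_esymm hMa hNa hT₁, cubic_eq_of_esymm hMb hNb hT₂,
    cubic_eq_of_esymm hMc hNc hT₃, cubic_eq_of_esymm hMd hNd hT₄, hK, hH, hT₁']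
  constructor <;> field_simp <;> ring
end

section
/- Let (a₁,a₂,a₃), (b₁,b₂,b₃), (c₁,c₂,c₃), (d₁,d₂,d₃) be four triples of rational numbers, all with the same sum M and the same product N, let T₁, T₂, T₃, T₄ denote the sums of pairwise products of the four triples, and assume T = T₁+T₂−T₃−T₄ ≠ 0. Define φ₁(x) = x³ + Mx² + ((4(T₁T₂−T₃T₄)+T²)/(4T))x + N, φ₂(x) = x³ + Mx² + ((4(T₁T₂−T₃T₄)−T²)/(4T))x + N, K = −(T² + 2(T₃+T₄)T − 4(T₁T₂−T₃T₄))/(2T), and H = (T²+4(T₁T₂−T₃T₄))²/(16T²) − T₁T₂. Then each of the twelve points (−a_i, φ₁(−a_i)), (−b_i, φ₁(−b_i)), (−c_i, φ₂(−c_i)), (−d_i, φ₂(−d_i)), i = 1, 2, 3, satisfies the quartic equation y² = Kx⁴ + MKx³ + Hx² + NKx. -/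
/-- If `f` and `g` are the cubics `x³ + Mx² + Ux + N` and `x³ + Mx² + Vx + N`, then the square of
`x³ + Mx² + px + N` differs from a quartic without constant term by `f x * g x`; the two agree
wherever `f` or `g` vanishes. -/
lemma sq_cubic_eq_quartic {R : Type*} [CommRing R] {M N U V p K H x : R}
    (hK : K = 2 * p - U - V) (hH : H = p ^ 2 - U * V)
    (h : (x ^ 3 + M * x ^ 2 + U * x + N) * (x ^ 3 + M * x ^ 2 + V * x + N) = 0) :
    (x ^ 3 + M * x ^ 2 + p * x + N) ^ 2 = K * x ^ 4 + M * K * x ^ 3 + H * x ^ 2 + N * K * x := by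
  subst hK hH
  linear_combination h

/-- The negatives of `u, v, w` are the roots of the monic cubic whose coefficients are the
elementary symmetric polynomials in `u, v, w`. -/
lemma cubic_neg_eq_zero {R : Type*} [CommRing R] {u v w M N U x : R}
    (hM : u + v + w = M) (hN : u * v * w = N) (hU : U = u * v + v * w + u * w)
    (hx : x = u ∨ x = v ∨ x = w) :
    (-x) ^ 3 + M * (-x) ^ 2 + U * (-x) + N = 0 := by
  subst hM hN hU
  rcases hx with rfl | rfl | rfl <;> ring

/-- Let four triples of rationals have the same sum `M`, the same product `N`, and
pairwise-product sums `T₁, T₂, T₃, T₄` with `T = T₁+T₂−T₃−T₄ ≠ 0`. With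
`φ₁(x) = x³ + Mx² + ((4(T₁T₂−T₃T₄)+T²)/(4T))x + N`,
`φ₂(x) = x³ + Mx² + ((4(T₁T₂−T₃T₄)−T²)/(4T))x + N`,
`K = −(T² + 2(T₃+T₄)T − 4(T₁T₂−T₃T₄))/(2T)`,
`H = (T²+4(T₁T₂−T₃T₄))²/(16T²) − T₁T₂`,
each of the twelve points `(−a_i, φ₁(−a_i))`, `(−b_i, φ₁(−b_i))`, `(−c_i, φ₂(−c_i))`,
`(−d_i, φ₂(−d_i))`, `i = 1, 2, 3`, satisfies `y² = Kx⁴ + MKx³ + Hx² + NKx`. -/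
theorem stmt_18 (a₁ a₂ a₃ b₁ b₂ b₃ c₁ c₂ c₃ d₁ d₂ d₃ M N T₁ T₂ T₃ T₄ T K H : ℚ)
    (hMa : a₁ + a₂ + a₃ = M) (hMb : b₁ + b₂ + b₃ = M)
    (hMc : c₁ + c₂ + c₃ = M) (hMd : d₁ + d₂ + d₃ = M)
    (hNa : a₁ * a₂ * a₃ = N) (hNb : b₁ * b₂ * b₃ = N)
    (hNc : c₁ * c₂ * c₃ = N) (hNd : d₁ * d₂ * d₃ = N)
    (hT₁ : T₁ = a₁ * a₂ + a₂ * a₃ + a₁ * a₃)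
    (hT₂ : T₂ = b₁ * b₂ + b₂ * b₃ + b₁ * b₃)
    (hT₃ : T₃ = c₁ * c₂ + c₂ * c₃ + c₁ * c₃)
    (hT₄ : T₄ = d₁ * d₂ + d₂ * d₃ + d₁ * d₃)
    (hT : T = T₁ + T₂ - T₃ - T₄) (hT0 : T ≠ 0)
    (φ₁ φ₂ : ℚ → ℚ)
    (hφ₁ : ∀ x, φ₁ x = x ^ 3 + M * x ^ 2
      + ((4 * (T₁ * T₂ - T₃ * T₄) + T ^ 2) / (4 * T)) * x + N)
    (hφ₂ : ∀ x, φ₂ x = x ^ 3 + M * x ^ 2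
      + ((4 * (T₁ * T₂ - T₃ * T₄) - T ^ 2) / (4 * T)) * x + N)
    (hK : K = -(T ^ 2 + 2 * (T₃ + T₄) * T - 4 * (T₁ * T₂ - T₃ * T₄)) / (2 * T))
    (hH : H = (T ^ 2 + 4 * (T₁ * T₂ - T₃ * T₄)) ^ 2 / (16 * T ^ 2) - T₁ * T₂) :
    (φ₁ (-a₁) ^ 2 = K * (-a₁) ^ 4 + M * K * (-a₁) ^ 3 + H * (-a₁) ^ 2 + N * K * (-a₁)) ∧
    (φ₁ (-a₂) ^ 2 = K * (-a₂) ^ 4 + M * K * (-a₂) ^ 3 + H * (-a₂) ^ 2 + N * K * (-a₂)) ∧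
    (φ₁ (-a₃) ^ 2 = K * (-a₃) ^ 4 + M * K * (-a₃) ^ 3 + H * (-a₃) ^ 2 + N * K * (-a₃)) ∧
    (φ₁ (-b₁) ^ 2 = K * (-b₁) ^ 4 + M * K * (-b₁) ^ 3 + H * (-b₁) ^ 2 + N * K * (-b₁)) ∧
    (φ₁ (-b₂) ^ 2 = K * (-b₂) ^ 4 + M * K * (-b₂) ^ 3 + H * (-b₂) ^ 2 + N * K * (-b₂)) ∧
    (φ₁ (-b₃) ^ 2 = K * (-b₃) ^ 4 + M * K * (-b₃) ^ 3 + H * (-b₃) ^ 2 + N * K * (-b₃)) ∧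
    (φ₂ (-c₁) ^ 2 = K * (-c₁) ^ 4 + M * K * (-c₁) ^ 3 + H * (-c₁) ^ 2 + N * K * (-c₁)) ∧
    (φ₂ (-c₂) ^ 2 = K * (-c₂) ^ 4 + M * K * (-c₂) ^ 3 + H * (-c₂) ^ 2 + N * K * (-c₂)) ∧
    (φ₂ (-c₃) ^ 2 = K * (-c₃) ^ 4 + M * K * (-c₃) ^ 3 + H * (-c₃) ^ 2 + N * K * (-c₃)) ∧
    (φ₂ (-d₁) ^ 2 = K * (-d₁) ^ 4 + M * K * (-d₁) ^ 3 + H * (-d₁) ^ 2 + N * K * (-d₁)) ∧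
    (φ₂ (-d₂) ^ 2 = K * (-d₂) ^ 4 + M * K * (-d₂) ^ 3 + H * (-d₂) ^ 2 + N * K * (-d₂)) ∧
    (φ₂ (-d₃) ^ 2 = K * (-d₃) ^ 4 + M * K * (-d₃) ^ 3 + H * (-d₃) ^ 2 + N * K * (-d₃)) := by
  have hK₁ : K = 2 * ((4 * (T₁ * T₂ - T₃ * T₄) + T ^ 2) / (4 * T)) - T₁ - T₂ := by
    rw [hK]
    field_simp
    linear_combination (-8 * T) * hT
  have hK₂ : K = 2 * ((4 * (T₁ * T₂ - T₃ * T₄) - T ^ 2) / (4 * T)) - T₃ - T₄ := by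
    rw [hK]
    field_simp
    ring
  have hH₁ : H = ((4 * (T₁ * T₂ - T₃ * T₄) + T ^ 2) / (4 * T)) ^ 2 - T₁ * T₂ := by
    rw [hH]
    field_simp
    ring
  have hH₂ : H = ((4 * (T₁ * T₂ - T₃ * T₄) - T ^ 2) / (4 * T)) ^ 2 - T₃ * T₄ := by
    rw [hH]
    field_simp
    ring
  have ha (x : ℚ) (hx : x = a₁ ∨ x = a₂ ∨ x = a₃) :
      φ₁ (-x) ^ 2 = K * (-x) ^ 4 + M * K * (-x) ^ 3 + H * (-x) ^ 2 + N * K * (-x) := by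
    rw [hφ₁]
    exact sq_cubic_eq_quartic hK₁ hH₁
      (mul_eq_zero_of_left (cubic_neg_eq_zero hMa hNa hT₁ hx) _)
  have hb (x : ℚ) (hx : x = b₁ ∨ x = b₂ ∨ x = b₃) :
      φ₁ (-x) ^ 2 = K * (-x) ^ 4 + M * K * (-x) ^ 3 + H * (-x) ^ 2 + N * K * (-x) := by
    rw [hφ₁]
    exact sq_cubic_eq_quartic hK₁ hH₁
      (mul_eq_zero_of_right _ (cubic_neg_eq_zero hMb hNb hT₂ hx))
  have hc (x : ℚ) (hx : x = c₁ ∨ x = c₂ ∨ x = c₃) :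
      φ₂ (-x) ^ 2 = K * (-x) ^ 4 + M * K * (-x) ^ 3 + H * (-x) ^ 2 + N * K * (-x) := by
    rw [hφ₂]
    exact sq_cubic_eq_quartic hK₂ hH₂
      (mul_eq_zero_of_left (cubic_neg_eq_zero hMc hNc hT₃ hx) _)
  have hd (x : ℚ) (hx : x = d₁ ∨ x = d₂ ∨ x = d₃) :
      φ₂ (-x) ^ 2 = K * (-x) ^ 4 + M * K * (-x) ^ 3 + H * (-x) ^ 2 + N * K * (-x) := by
    rw [hφ₂]
    exact sq_cubic_eq_quartic hK₂ hH₂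
      (mul_eq_zero_of_right _ (cubic_neg_eq_zero hMd hNd hT₄ hx))
  exact ⟨ha _ (by simp), ha _ (by simp), ha _ (by simp),
    hb _ (by simp), hb _ (by simp), hb _ (by simp),
    hc _ (by simp), hc _ (by simp), hc _ (by simp),
    hd _ (by simp), hd _ (by simp), hd _ (by simp)⟩
end
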